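/- Let X be a quasi-median graph and let A, B be hyperplanes of X with d_{CX}(A,B) ≥ 2 in the contact graph CX. Then there exist a midpoint M of some geodesic between A and B in CX and a hyperplane C separating the carriers N(A) and N(B) such that d_{CX}(M,C) ≤ 3/2. -/

import Mathlib

namespace QM

variable {V : Type*}

/-- `y₁` and `y₂` lie (in this order) on a common geodesic from `x₁` to `x₂`. -/
def OnGeod (X : SimpleGraph V) (x₁ y₁ y₂ x₂ : V) : Prop :=
  X.dist x₁ y₁ + X.dist y₁ y₂ + X.dist y₂ x₂ = X.dist x₁ x₂

/-- `(y₁, y₂, y₃)` is a `k`-quasi-median triple for `(x₁, x₂, x₃)` (without minimality). -/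
def IsQMTriple (X : SimpleGraph V) (x₁ x₂ x₃ y₁ y₂ y₃ : V) (k : ℕ) : Prop :=
  OnGeod X x₁ y₁ y₂ x₂ ∧ OnGeod X x₁ y₁ y₃ x₃ ∧ OnGeod X x₂ y₂ y₃ x₃ ∧
    X.dist y₁ y₂ = k ∧ X.dist y₁ y₃ = k ∧ X.dist y₂ y₃ = k

/-- `y` is a quasi-median of the triple `(x₁, x₂, x₃)`: it is a `k`-quasi-median triple
with `k` as small as possible. -/
def IsQuasiMedianTriple (X : SimpleGraph V) (x₁ x₂ x₃ : V) (y : V × V × V) : Prop :=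
  ∃ k : ℕ, IsQMTriple X x₁ x₂ x₃ y.1 y.2.1 y.2.2 k ∧
    ∀ (k' : ℕ) (z₁ z₂ z₃ : V), IsQMTriple X x₁ x₂ x₃ z₁ z₂ z₃ k' → k ≤ k'

/-- The complete multipartite graph `K_{1,1,2}`: the complete graph on four vertices
with the edge between vertices `2` and `3` removed. -/
def K112 : SimpleGraph (Fin 4) :=
  SimpleGraph.fromRel (fun i j => ¬(i = 2 ∧ j = 3) ∧ ¬(i = 3 ∧ j = 2))

/-- The 1-skeleton of the 3-cube. -/
def cubeGraph : SimpleGraph (Fin 3 → Bool) :=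
  SimpleGraph.fromRel (fun x y => ∃! i, x i ≠ y i)

/-- The 6-cycle. -/
def C6 : SimpleGraph (Fin 6) := SimpleGraph.fromRel (fun i j => j = i + 1)

/-- A set of vertices is convex if it contains every vertex lying on a geodesic between
two of its members. -/
def IsConvexSet (X : SimpleGraph V) (S : Set V) : Prop :=
  ∀ x ∈ S, ∀ y ∈ S, ∀ z : V, X.dist x z + X.dist z y = X.dist x y → z ∈ S

/-- The convex hull of a set of vertices. -/
def convexHullSet (X : SimpleGraph V) (S : Set V) : Set V :=
  ⋂₀ {T : Set V | S ⊆ T ∧ IsConvexSet X T}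

/-- A quasi-median graph: a connected graph in which every triple of vertices has a unique
quasi-median, with no induced `K_{1,1,2}`, and in which the convex hull of every isometrically
embedded 6-cycle is isomorphic to the 3-cube. -/
structure IsQuasiMedian (X : SimpleGraph V) : Prop where
  connected : X.Connected
  uniqueQuasiMedian : ∀ x₁ x₂ x₃ : V, ∃! y : V × V × V, IsQuasiMedianTriple X x₁ x₂ x₃ y
  noK112 : IsEmpty (SimpleGraph.Embedding K112 X)
  hullOfC6IsCube : ∀ f : Fin 6 → V,
    (∀ i j, C6.Adj i j → X.Adj (f i) (f j)) →
    (∀ i j, X.dist (f i) (f j) = C6.dist i j) →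
    Nonempty (SimpleGraph.Iso
      (SimpleGraph.induce (convexHullSet X (Set.range f)) X) cubeGraph)

/-- Two edges are two sides of a common triangle, or opposite sides of a common square. -/
def SideRel (X : SimpleGraph V) (e f : Sym2 V) : Prop :=
  (∃ a b c : V, X.Adj a b ∧ X.Adj a c ∧ X.Adj b c ∧ e = s(a, b) ∧ f = s(a, c)) ∨
  (∃ a b c d : V, X.Adj a b ∧ X.Adj c d ∧ X.Adj a c ∧ X.Adj b d ∧ a ≠ d ∧ b ≠ c ∧
    e = s(a, b) ∧ f = s(c, d))

/-- The equivalence class of an edge under the equivalence relation generated by `SideRel`. -/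
def hypClass (X : SimpleGraph V) (e : Sym2 V) : Set (Sym2 V) :=
  {f | Relation.EqvGen (SideRel X) e f}

/-- A hyperplane: the equivalence class of some edge of `X`. -/
def IsHyperplane (X : SimpleGraph V) (H : Set (Sym2 V)) : Prop :=
  ∃ e ∈ X.edgeSet, H = hypClass X e

/-- The type of hyperplanes of `X`. -/
def Hyperplane (X : SimpleGraph V) := {H : Set (Sym2 V) // IsHyperplane X H}

/-- Edges `e`, `e'` sharing the endpoint `p`, not lying in a common clique, that are
adjacent sides of a square of `X`: their dual hyperplanes intersect at `p`. -/
def IntersectAt (X : SimpleGraph V) (e e' : Sym2 V) (p : V) : Prop :=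
  ∃ a b : V, e = s(p, a) ∧ e' = s(p, b) ∧ X.Adj p a ∧ X.Adj p b ∧ a ≠ b ∧ ¬ X.Adj a b ∧
    ∃ q : V, q ≠ p ∧ X.Adj a q ∧ X.Adj b q

/-- Edges `e`, `e'` sharing the endpoint `p`, not lying in a common clique, and not adjacent
sides of any square of `X`: their dual hyperplanes osculate at `p`. -/
def OsculateAt (X : SimpleGraph V) (e e' : Sym2 V) (p : V) : Prop :=
  ∃ a b : V, e = s(p, a) ∧ e' = s(p, b) ∧ X.Adj p a ∧ X.Adj p b ∧ a ≠ b ∧ ¬ X.Adj a b ∧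
    ¬ ∃ q : V, q ≠ p ∧ X.Adj a q ∧ X.Adj b q

/-- Hyperplanes `H` and `H'` intersect at `p`. -/
def HypIntersectAt (X : SimpleGraph V) (H H' : Hyperplane X) (p : V) : Prop :=
  ∃ e ∈ H.1, ∃ e' ∈ H'.1, IntersectAt X e e' p

/-- Hyperplanes `H` and `H'` osculate at `p`. -/
def HypOsculateAt (X : SimpleGraph V) (H H' : Hyperplane X) (p : V) : Prop :=
  ∃ e ∈ H.1, ∃ e' ∈ H'.1, OsculateAt X e e' p

/-- Hyperplanes `H` and `H'` intersect. -/
def HypIntersect (X : SimpleGraph V) (H H' : Hyperplane X) : Prop :=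
  ∃ p : V, HypIntersectAt X H H' p

/-- Hyperplanes `H` and `H'` osculate. -/
def HypOsculate (X : SimpleGraph V) (H H' : Hyperplane X) : Prop :=
  ∃ p : V, HypOsculateAt X H H' p

/-- The contact graph `𝒞X`: hyperplanes are adjacent iff they intersect or osculate. -/
def contactGraph (X : SimpleGraph V) : SimpleGraph (Hyperplane X) :=
  SimpleGraph.fromRel (fun H H' => HypIntersect X H H' ∨ HypOsculate X H H')

/-- The crossing graph `ΔX`: hyperplanes are adjacent iff they intersect. -/
def crossingGraph (X : SimpleGraph V) : SimpleGraph (Hyperplane X) :=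
  SimpleGraph.fromRel (fun H H' => HypIntersect X H H')

/-- The (vertex set of the) carrier of a hyperplane: all endpoints of its edges. -/
def hypCarrier (X : SimpleGraph V) (H : Hyperplane X) : Set V :=
  {v : V | ∃ e ∈ H.1, v ∈ e}

/-- A set of edges `H` (e.g. a hyperplane) separates `p` from `q` if every walk from `p`
to `q` uses an edge of `H`. -/
def Separates (X : SimpleGraph V) (H : Set (Sym2 V)) (p q : V) : Prop :=
  ∀ w : X.Walk p q, ∃ e ∈ w.edges, e ∈ H

/-- `f` is a `(λ, c)`-quasi-isometry from `(A, dA)` to `(B, dB)`. -/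
def IsQuasiIsometry {A B : Type*} (lam c : ℝ) (dA : A → A → ℝ) (dB : B → B → ℝ)
    (f : A → B) : Prop :=
  (∀ x y : A, dA x y / lam - c ≤ dB (f x) (f y) ∧ dB (f x) (f y) ≤ lam * dA x y + c) ∧
    ∀ b : B, ∃ a : A, dB (f a) b ≤ c

end QM

namespace QM

/-- A set of edges `H` separates the vertex sets `P` and `Q` if it separates no two vertices
of `P`, no two vertices of `Q`, but separates some vertex of `P` from some vertex of `Q`. -/
def SeparatesSets {V : Type*} (X : SimpleGraph V) (H : Set (Sym2 V)) (P Q : Set V) : Prop :=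
  (∀ x ∈ P, ∀ y ∈ P, ¬ Separates X H x y) ∧ (∀ x ∈ Q, ∀ y ∈ Q, ¬ Separates X H x y) ∧
    (∃ x ∈ P, ∃ y ∈ Q, Separates X H x y)

section

variable {V : Type*} {X : SimpleGraph V}

lemma dist_le_of_adj (hX : IsQuasiMedian X) {a b : V} (h : X.Adj a b) (v : V) :
    X.dist v a ≤ X.dist v b + 1 := by
  have h1 := hX.connected.dist_triangle (u := v) (v := b) (w := a)
  rw [SimpleGraph.dist_eq_one_iff_adj.2 h.symm] at h1
  exact h1

lemma exists_adj_closer (hX : IsQuasiMedian X) {p q : V} (h : p ≠ q) :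
    ∃ p', X.Adj p p' ∧ X.dist p' q + 1 = X.dist p q := by
  obtain ⟨w, hw⟩ := (hX.connected p q).exists_walk_length_eq_dist
  cases w with
  | nil => exact absurd rfl h
  | cons hadj w' =>
    rename_i p'
    refine ⟨p', hadj, ?_⟩
    have h1 := SimpleGraph.dist_le w'
    have h2 := dist_le_of_adj hX hadj q
    rw [X.dist_comm (u := q), X.dist_comm (u := q)] at h2
    rw [SimpleGraph.Walk.length_cons] at hw
    omega

lemma dist_eq_two (hX : IsQuasiMedian X) {x y u : V} (hxu : X.Adj x u) (huy : X.Adj u y)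
    (hne : x ≠ y) (hxy : ¬ X.Adj x y) : X.dist x y = 2 := by
  have h1 := hX.connected.dist_triangle (u := x) (v := u) (w := y)
  rw [SimpleGraph.dist_eq_one_iff_adj.2 hxu, SimpleGraph.dist_eq_one_iff_adj.2 huy] at h1
  have h2 : X.dist x y ≠ 0 := fun h => hne (hX.connected.dist_eq_zero_iff.1 h)
  have h3 : X.dist x y ≠ 1 := fun h => hxy (SimpleGraph.dist_eq_one_iff_adj.1 h)
  omega

/-- Two triangles sharing an edge span a complete graph. -/
lemma adj_of_common_edge (hX : IsQuasiMedian X) {a b c d : V} (hab : X.Adj a b)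
    (hac : X.Adj a c) (hbc : X.Adj b c) (had : X.Adj a d) (hbd : X.Adj b d) (hcd : c ≠ d) :
    X.Adj c d := by
  by_contra hn
  refine hX.noK112.false ⟨⟨![a, b, c, d], ?_⟩, ?_⟩
  · intro i j hij
    have := hab.ne; have := hac.ne; have := hbc.ne; have := had.ne; have := hbd.ne
    fin_cases i <;> fin_cases j <;> simp_all [Ne.symm]
  · intro i j
    have hn' : ¬ X.Adj d c := fun h => hn h.symm
    change X.Adj (![a, b, c, d] i) (![a, b, c, d] j) ↔ _
    fin_cases i <;> fin_cases j <;>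
      simp [K112, hab, hac, hbc, had, hbd, hn, hn', hab.symm, hac.symm, hbc.symm, had.symm,
        hbd.symm]

/-- Three pairwise non-adjacent vertices have at most one common neighbour. -/
lemma common_neighbor_unique (hX : IsQuasiMedian X) {x y z u w : V} (hxy : x ≠ y) (hxz : x ≠ z)
    (hyz : y ≠ z) (nxy : ¬ X.Adj x y) (nxz : ¬ X.Adj x z) (nyz : ¬ X.Adj y z)
    (hux : X.Adj u x) (huy : X.Adj u y) (huz : X.Adj u z)
    (hwx : X.Adj w x) (hwy : X.Adj w y) (hwz : X.Adj w z) : u = w := by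
  have key : ∀ u, X.Adj u x → X.Adj u y → X.Adj u z →
      IsQuasiMedianTriple X x y z (u, u, u) := by
    intro u hux huy huz
    refine ⟨0, ?_, fun _ _ _ _ _ => Nat.zero_le _⟩
    simp [IsQMTriple, OnGeod, dist_eq_two hX hux.symm huy hxy nxy,
      dist_eq_two hX hux.symm huz hxz nxz, dist_eq_two hX huy.symm huz hyz nyz,
      SimpleGraph.dist_eq_one_iff_adj.2 hux.symm, SimpleGraph.dist_eq_one_iff_adj.2 huy.symm,
      SimpleGraph.dist_eq_one_iff_adj.2 huy, SimpleGraph.dist_eq_one_iff_adj.2 huz]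
  have := (hX.uniqueQuasiMedian x y z).unique (key u hux huy huz) (key w hwx hwy hwz)
  exact congrArg Prod.fst this

/-- The triangle condition. -/
lemma triangle_condition (hX : IsQuasiMedian X) {v x y : V} (hxy : X.Adj x y)
    (h : X.dist v x = X.dist v y) :
    ∃ z, X.Adj z x ∧ X.Adj z y ∧ X.dist v z + 1 = X.dist v x := by
  obtain ⟨⟨z, x', y'⟩, ⟨k, ⟨h1, h2, h3, h4, h5, h6⟩, -⟩, -⟩ := hX.uniqueQuasiMedian v x y
  simp only [OnGeod] at h1 h2 h3 h4 h5 h6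
  have hd := SimpleGraph.dist_eq_one_iff_adj.2 hxy
  have hx : x' = x := by
    refine (hX.connected.dist_eq_zero_iff.1 ?_).symm
    have := X.dist_comm (u := x) (v := x')
    omega
  have hy : y' = y := by
    refine hX.connected.dist_eq_zero_iff.1 ?_
    have := X.dist_comm (u := x) (v := x')
    omega
  subst hx hy
  simp only [SimpleGraph.dist_self] at h1 h2 h3
  refine ⟨z, SimpleGraph.dist_eq_one_iff_adj.1 (by omega),
    SimpleGraph.dist_eq_one_iff_adj.1 (by omega), by omega⟩

lemma dist_eq_of_step {W : Type*} {G : SimpleGraph W} (v : W) (f : W → ℕ)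
    (h0 : ∀ w, f w = 0 ↔ w = v) (hadj : ∀ a b, G.Adj a b → f b ≤ f a + 1)
    (hstep : ∀ a, f a ≠ 0 → ∃ b, G.Adj b a ∧ f a = f b + 1) (w : W) : G.dist v w = f w := by
  have lower : ∀ {a b : W} (p : G.Walk a b), f b ≤ f a + p.length := by
    intro a b p
    induction p with
    | nil => simp
    | cons h p ih =>
      have := hadj _ _ h
      rw [SimpleGraph.Walk.length_cons]
      omega
  have upper : ∀ n w, f w = n → ∃ p : G.Walk v w, p.length = n := by
    intro n
    induction n with
    | zero =>
      intro w hw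
      obtain rfl := (h0 w).1 hw
      exact ⟨.nil, rfl⟩
    | succ n ih =>
      intro w hw
      obtain ⟨b, hb, hwb⟩ := hstep w (by omega)
      obtain ⟨p, hp⟩ := ih b (by omega)
      exact ⟨p.concat hb, by simp [hp]⟩
  obtain ⟨p, hp⟩ := upper _ w rfl
  obtain ⟨q, hq⟩ := p.reachable.exists_walk_length_eq_dist
  have h1 := SimpleGraph.dist_le p
  have h2 := lower q
  rw [(h0 v).2 rfl] at h2
  omega

lemma C6_adj (i j : Fin 6) : C6.Adj i j ↔ i ≠ j ∧ (j = i + 1 ∨ i = j + 1) := Iff.rfl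

lemma C6_dist (i j : Fin 6) : C6.dist i j = min (i - j : Fin 6).val (j - i : Fin 6).val := by
  refine dist_eq_of_step i (fun j => min (i - j : Fin 6).val (j - i : Fin 6).val) ?_ ?_ ?_ j <;>
    (try simp only [C6_adj]) <;> revert i <;> decide +kernel

lemma cubeGraph_adj_iff (x y : Fin 3 → Bool) : cubeGraph.Adj x y ↔
    (x 0 ^^ y 0).toNat + (x 1 ^^ y 1).toNat + (x 2 ^^ y 2).toNat = 1 := by
  have h : ∀ x y : Fin 3 → Bool, (∃ i, x i ≠ y i ∧ ∀ j, x j ≠ y j → j = i) ↔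
      (x 0 ^^ y 0).toNat + (x 1 ^^ y 1).toNat + (x 2 ^^ y 2).toNat = 1 := by decide +kernel
  simp only [cubeGraph, ExistsUnique, SimpleGraph.fromRel_adj, h, Bool.xor_comm (y _), or_self,
    and_iff_right_iff_imp]
  rintro h rfl
  simp at h

lemma cubeGraph_parity {x y : Fin 3 → Bool} (h : cubeGraph.Adj x y) :
    (x 0 ^^ x 1 ^^ x 2) = !(y 0 ^^ y 1 ^^ y 2) := by
  rw [cubeGraph_adj_iff] at h
  revert h
  generalize x 0 = x0, x 1 = x1, x 2 = x2, y 0 = y0, y 1 = y1, y 2 = y2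
  revert x0 x1 x2 y0 y1 y2
  decide

lemma cubeGraph_common_neighbor {x y w u a : Fin 3 → Bool} (hxy : x ≠ y) (hxw : x ≠ w)
    (hyw : y ≠ w) (hux : cubeGraph.Adj u x) (huy : cubeGraph.Adj u y) (hax : cubeGraph.Adj a x)
    (haw : cubeGraph.Adj a w) :
    ∃ z, cubeGraph.Adj z x ∧ cubeGraph.Adj z y ∧ cubeGraph.Adj z w := by
  have h1 := (cubeGraph_parity hux).symm.trans (cubeGraph_parity huy)
  have h2 := (cubeGraph_parity hax).symm.trans (cubeGraph_parity haw)
  simp only [cubeGraph_adj_iff]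
  have key : ∀ x y w : Fin 3 → Bool, x ≠ y → x ≠ w → y ≠ w →
    (!(x 0 ^^ x 1 ^^ x 2)) = (!(y 0 ^^ y 1 ^^ y 2)) →
    (!(x 0 ^^ x 1 ^^ x 2)) = (!(w 0 ^^ w 1 ^^ w 2)) →
    ∃ z : Fin 3 → Bool, (z 0 ^^ x 0).toNat + (z 1 ^^ x 1).toNat + (z 2 ^^ x 2).toNat = 1 ∧
      (z 0 ^^ y 0).toNat + (z 1 ^^ y 1).toNat + (z 2 ^^ y 2).toNat = 1 ∧
      (z 0 ^^ w 0).toNat + (z 1 ^^ w 1).toNat + (z 2 ^^ w 2).toNat = 1 := by decide +kernel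
  exact key _ _ _ hxy hxw hyw h1 h2

/-- Alternate vertices of an isometric `6`-cycle have a common neighbour. -/
lemma exists_common_neighbor_of_hexagon (hX : IsQuasiMedian X) {u x a w b y : V}
    (hux : X.Adj u x) (hxa : X.Adj x a) (haw : X.Adj a w) (hwb : X.Adj w b) (hby : X.Adj b y)
    (hyu : X.Adj y u) (hua : X.dist u a = 2) (huw : X.dist u w = 3) (hub : X.dist u b = 2)
    (hxw : X.dist x w = 2) (hxb : X.dist x b = 3) (hxy : X.dist x y = 2) (hab : X.dist a b = 2)
    (hay : X.dist a y = 3) (hwy : X.dist w y = 2) :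
    ∃ z, X.Adj z x ∧ X.Adj z y ∧ X.Adj z w := by
  have hadj : ∀ i j, C6.Adj i j → X.Adj (![u, x, a, w, b, y] i) (![u, x, a, w, b, y] j) := by
    have : ∀ i, X.Adj (![u, x, a, w, b, y] i) (![u, x, a, w, b, y] (i + 1)) := by
      intro i
      fin_cases i <;> assumption
    rintro i j ⟨-, rfl | rfl⟩
    exacts [this i, (this j).symm]
  obtain ⟨φ⟩ := hX.hullOfC6IsCube ![u, x, a, w, b, y] hadj (by
    have h1 : ∀ {p q : V}, X.Adj p q → X.dist p q = 1 :=
      fun h => SimpleGraph.dist_eq_one_iff_adj.2 h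
    have key : ∀ i j : Fin 6, i ≤ j →
        X.dist (![u, x, a, w, b, y] i) (![u, x, a, w, b, y] j) = C6.dist i j := by
      intro i j hij
      rw [C6_dist]
      fin_cases i <;> fin_cases j <;>
        first
        | exact absurd hij (by decide)
        | exact SimpleGraph.dist_self
        | exact h1 (by assumption)
        | exact h1 (SimpleGraph.Adj.symm (by assumption))
        | assumption
    intro i j
    rcases le_total i j with h | h
    · exact key i j h
    · rw [X.dist_comm, C6.dist_comm]
      exact key j i h)
  have hmem : ∀ i, ![u, x, a, w, b, y] i ∈
      convexHullSet X (Set.range ![u, x, a, w, b, y]) :=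
    fun i => Set.mem_sInter.2 fun T hT => hT.1 ⟨i, rfl⟩
  let ψ : Fin 6 → (Fin 3 → Bool) := fun i => φ ⟨_, hmem i⟩
  have hψ : ∀ i j, C6.Adj i j → cubeGraph.Adj (ψ i) (ψ j) :=
    fun i j h => φ.map_rel_iff.2 (hadj i j h)
  have hne : ∀ i j, X.dist (![u, x, a, w, b, y] i) (![u, x, a, w, b, y] j) ≠ 0 →
      ψ i ≠ ψ j := by
    intro i j h hij
    have := congrArg Subtype.val (φ.injective hij)
    simp only at this
    rw [this, SimpleGraph.dist_self] at h
    exact h rfl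
  have hC : ∀ i j : Fin 6, (i ≠ j ∧ (j = i + 1 ∨ i = j + 1)) → C6.Adj i j := fun _ _ h => h
  obtain ⟨z, hzx, hzy, hzw⟩ := cubeGraph_common_neighbor (x := ψ 1) (y := ψ 5) (w := ψ 3)
    (u := ψ 0) (a := ψ 2) (hne 1 5 (ne_of_eq_of_ne hxy (by decide)))
    (hne 1 3 (ne_of_eq_of_ne hxw (by decide)))
    (hne 5 3 (ne_of_eq_of_ne ((X.dist_comm).trans hwy) (by decide)))
    (hψ 0 1 (hC _ _ (by decide))) (hψ 0 5 (hC _ _ (by decide))) (hψ 2 1 (hC _ _ (by decide)))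
    (hψ 2 3 (hC _ _ (by decide)))
  obtain ⟨z', rfl⟩ := φ.surjective z
  exact ⟨z'.1, φ.map_rel_iff.1 hzx, φ.map_rel_iff.1 hzy, φ.map_rel_iff.1 hzw⟩

/-- The quadrangle condition. -/
lemma quadrangle_condition (hX : IsQuasiMedian X) {v u x y : V} {k : ℕ} (hux : X.Adj u x)
    (huy : X.Adj u y) (hne : x ≠ y) (hxy : ¬ X.Adj x y) (hu : X.dist v u = k + 1)
    (hx : X.dist v x = k) (hy : X.dist v y = k) :
    ∃ z, X.Adj z x ∧ X.Adj z y ∧ X.dist v z + 1 = k := by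
  have hd := dist_eq_two hX hux.symm huy hne hxy
  have one : ∀ {p q : V}, X.Adj p q → X.dist p q = 1 :=
    fun h => SimpleGraph.dist_eq_one_iff_adj.2 h
  have tri : ∀ a b c : V, X.dist a c ≤ X.dist a b + X.dist b c :=
    fun a b c => hX.connected.dist_triangle
  obtain ⟨⟨w, x', y'⟩, ⟨m, ⟨h1, h2, h3, h4, h5, h6⟩, hmin⟩, -⟩ := hX.uniqueQuasiMedian v x y
  simp only [OnGeod] at h1 h2 h3 h4 h5 h6
  have c1 := X.dist_comm (u := x) (v := x')
  have hm : m = 0 ∨ m = 2 := by omega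
  rcases hm with rfl | rfl
  · obtain rfl := hX.connected.dist_eq_zero_iff.1 h4
    obtain rfl := hX.connected.dist_eq_zero_iff.1 h5
    simp only [SimpleGraph.dist_self] at h1 h2 h3
    exact ⟨w, SimpleGraph.dist_eq_one_iff_adj.1 (by omega),
      SimpleGraph.dist_eq_one_iff_adj.1 (by omega), by omega⟩
  obtain rfl : x = x' := hX.connected.dist_eq_zero_iff.1 (by omega)
  obtain rfl : y' = y := hX.connected.dist_eq_zero_iff.1 (by omega)
  simp only [SimpleGraph.dist_self] at h1 h2 h3
  by_contra hcon
  have nocommon : ∀ z, X.Adj z x → X.Adj z y' → X.Adj z w → False := by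
    intro z hzx hzy hzw
    refine hcon ⟨z, hzx, hzy, ?_⟩
    have := dist_le_of_adj hX hzw v
    have := dist_le_of_adj hX hzx.symm v
    omega
  obtain ⟨a, hxa, ha⟩ := exists_adj_closer hX (p := x) (q := w) (by rintro rfl; simp at h4)
  obtain ⟨b, hyb, hb⟩ := exists_adj_closer hX (p := y') (q := w) (by rintro rfl; simp at h5)
  have c2 := X.dist_comm (u := x) (v := w)
  have c3 := X.dist_comm (u := y') (v := w)
  have haw : X.Adj a w := SimpleGraph.dist_eq_one_iff_adj.1 (by omega)
  have hbw : X.Adj b w := SimpleGraph.dist_eq_one_iff_adj.1 (by omega)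
  have level : ∀ c, X.Adj c w → (X.Adj c x ∨ X.Adj c y') → X.dist v c + 1 = k ∧ X.dist u c = 2 := by
    intro c hcw hc
    have e1 := dist_le_of_adj hX hcw v
    have e2 : X.dist v x ≤ X.dist v c + 1 ∨ X.dist v y' ≤ X.dist v c + 1 :=
      hc.imp (fun h => dist_le_of_adj hX h.symm v) (fun h => dist_le_of_adj hX h.symm v)
    have e3 := tri v c u
    have e4 : X.dist u c ≤ 2 := by
      rcases hc with h | h
      · have := tri u x c; rw [one hux, one h.symm] at this; exact this
      · have := tri u y' c; rw [one huy, one h.symm] at this; exact this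
    have e5 := X.dist_comm (u := u) (v := c)
    omega
  have noadj : ∀ a b, X.Adj a w → X.Adj b w → X.Adj a x → X.Adj b y' → ¬ X.Adj a b := by
    intro a b haw hbw hax hby hab
    obtain ⟨ha1, ha2⟩ := level a haw (.inl hax)
    obtain ⟨hb1, hb2⟩ := level b hbw (.inr hby)
    obtain ⟨t, hta, htb, ht⟩ := triangle_condition hX hab (ha2.trans hb2.symm)
    have htu : X.dist u t = 1 := by omega
    have e1 := tri v t u
    have e2 := X.dist_comm (u := u) (v := t)
    have htw : t ≠ w := by rintro rfl; omega
    have := dist_le_of_adj hX (adj_of_common_edge hX hab hta.symm htb.symm haw hbw htw) v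
    omega
  have hxb : X.dist x b = 3 := by
    have e1 := tri x w b
    rw [one hbw.symm] at e1
    have e2 : X.dist x b ≠ 0 := by
      intro h
      obtain rfl := hX.connected.dist_eq_zero_iff.1 h
      exact hxy hyb.symm
    have e3 : X.dist x b ≠ 1 := fun h =>
      nocommon b (SimpleGraph.dist_eq_one_iff_adj.1 h).symm hyb.symm hbw
    have e4 : X.dist x b ≠ 2 := by
      intro h
      obtain ⟨t, htb, htw, ht⟩ := triangle_condition hX hbw (v := x) (by omega)
      exact noadj t b htw hbw (SimpleGraph.dist_eq_one_iff_adj.1 (by omega) : X.Adj x t).symm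
        hyb.symm htb
    omega
  have hay : X.dist a y' = 3 := by
    rw [X.dist_comm]
    have e1 := tri y' w a
    rw [one haw.symm] at e1
    have e2 : X.dist y' a ≠ 0 := by
      intro h
      obtain rfl := hX.connected.dist_eq_zero_iff.1 h
      exact hxy hxa
    have e3 : X.dist y' a ≠ 1 := fun h =>
      nocommon a hxa.symm (SimpleGraph.dist_eq_one_iff_adj.1 h).symm haw
    have e4 : X.dist y' a ≠ 2 := by
      intro h
      obtain ⟨t, hta, htw, ht⟩ := triangle_condition hX haw (v := y') (by omega)
      exact noadj a t haw htw hxa.symm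
        (SimpleGraph.dist_eq_one_iff_adj.1 (by omega) : X.Adj y' t).symm hta.symm
    omega
  have hab : X.dist a b = 2 := by
    refine dist_eq_two hX haw hbw.symm ?_ (noadj a b haw hbw hxa.symm hyb.symm)
    rintro rfl
    rw [one hxa] at hxb
    omega
  have huw : X.dist u w = 3 := by
    have e1 := tri u x w
    have e2 := tri v w u
    rw [one hux] at e1
    rw [X.dist_comm (u := w)] at e2
    omega
  obtain ⟨z, hz1, hz2, hz3⟩ := exists_common_neighbor_of_hexagon hX hux hxa haw hbw.symm hyb.symm
    huy.symm (level a haw (.inl hxa.symm)).2 huw (level b hbw (.inr hyb.symm)).2 (by omega) hxb hd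
    hab hay (by omega)
  exact nocommon z hz1 hz2 hz3

variable (X) in
/-- The set of vertices strictly closer to `a` than to `b`. -/
def closerSet (a b : V) : Set V := {v | X.dist v a < X.dist v b}

lemma mem_closerSet {a b v : V} : v ∈ closerSet X a b ↔ X.dist v a < X.dist v b := Iff.rfl

lemma left_mem_closerSet {a b : V} (h : X.Adj a b) : a ∈ closerSet X a b := by
  rw [mem_closerSet, SimpleGraph.dist_self, SimpleGraph.dist_eq_one_iff_adj.2 h]
  exact Nat.one_pos

lemma not_mem_closerSet_swap {a b v : V} (h : v ∈ closerSet X a b) : v ∉ closerSet X b a :=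
  fun h' => lt_asymm (mem_closerSet.1 h) (mem_closerSet.1 h')

lemma dist_add_one_of_mem_closerSet (hX : IsQuasiMedian X) {a b v : V} (hab : X.Adj a b)
    (h : v ∈ closerSet X a b) : X.dist v a + 1 = X.dist v b := by
  have := dist_le_of_adj hX hab.symm v
  rw [mem_closerSet] at h
  omega

lemma closerSet_subset_of_triangle (hX : IsQuasiMedian X) {a b c : V} (hab : X.Adj a b)
    (hac : X.Adj a c) (hbc : X.Adj b c) : closerSet X a b ⊆ closerSet X a c := by
  intro v hv
  have h1 := dist_add_one_of_mem_closerSet hX hab hv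
  have h2 := dist_le_of_adj hX hbc v
  rcases (show X.dist v a < X.dist v c ∨ X.dist v a = X.dist v c by omega) with h | h
  · exact h
  obtain ⟨t, hta, htc, ht⟩ := triangle_condition hX hac h
  have hne : t ≠ b := by rintro rfl; omega
  have := dist_le_of_adj hX (adj_of_common_edge hX hac hta.symm htc.symm hab hbc.symm hne).symm v
  omega

lemma closerSet_eq_of_triangle (hX : IsQuasiMedian X) {a b c : V} (hab : X.Adj a b)
    (hac : X.Adj a c) (hbc : X.Adj b c) : closerSet X a b = closerSet X a c :=
  (closerSet_subset_of_triangle hX hab hac hbc).antisymm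
    (closerSet_subset_of_triangle hX hac hab hbc.symm)

/-- In an induced square `a b d c`, a vertex closer to `a` than to `b` which is not closer to `c`
than to `d` is at distance one more from `c` and `d` than from `a`. -/
lemma dist_of_square_of_not_lt (hX : IsQuasiMedian X) {a b c d v : V} (hab : X.Adj a b)
    (hcd : X.Adj c d) (hac : X.Adj a c) (hbd : X.Adj b d) (had : a ≠ d) (hbc : b ≠ c)
    (nad : ¬ X.Adj a d) (nbc : ¬ X.Adj b c) (hv : X.dist v a < X.dist v b)
    (hn : ¬ X.dist v c < X.dist v d) :
    X.dist v c = X.dist v a + 1 ∧ X.dist v d = X.dist v a + 1 := by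
  have h1 := dist_add_one_of_mem_closerSet hX hab hv
  have h2 := dist_le_of_adj hX hac.symm v
  have h3 := dist_le_of_adj hX hbd v
  by_contra hcon
  have hd : X.dist v d = X.dist v a := by omega
  obtain ⟨z, hza, hzd, hz⟩ := quadrangle_condition hX hab.symm hbd had nad h1.symm rfl hd
  have hbz : b ≠ z := by rintro rfl; omega
  have nbz : ¬ X.Adj b z := fun h => by have := dist_le_of_adj hX h v; omega
  have hcz : c ≠ z := by rintro rfl; omega
  have ncz : ¬ X.Adj c z := fun h =>
    nad (adj_of_common_edge hX h hac.symm hza hcd hzd had)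
  exact had (common_neighbor_unique hX hbc hbz hcz nbc nbz ncz hab hac hza.symm hbd.symm hcd.symm
    hzd.symm)

lemma closerSet_subset_of_square (hX : IsQuasiMedian X) {a b c d : V} (hab : X.Adj a b)
    (hcd : X.Adj c d) (hac : X.Adj a c) (hbd : X.Adj b d) (had : a ≠ d) (hbc : b ≠ c)
    (nad : ¬ X.Adj a d) (nbc : ¬ X.Adj b c) : closerSet X a b ⊆ closerSet X c d := by
  intro v hv
  by_contra hn
  obtain ⟨hc, hd⟩ := dist_of_square_of_not_lt hX hab hcd hac hbd had hbc nad nbc hv hn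
  have hb := dist_add_one_of_mem_closerSet hX hab hv
  obtain ⟨w, hwb, hwd, hw⟩ := triangle_condition hX hbd (hb.symm.trans hd.symm)
  have haw : a ≠ w := by rintro rfl; exact nad hwd
  have naw : ¬ X.Adj a w := fun h =>
    nad (adj_of_common_edge hX hwb h.symm hab.symm hwd hbd had)
  have hcw : c ≠ w := by rintro rfl; exact nbc hwb.symm
  have ncw : ¬ X.Adj c w := fun h =>
    nbc (adj_of_common_edge hX hwd h.symm hcd.symm hwb hbd.symm hbc.symm).symm
  have e1 := dist_eq_two hX hwb hab.symm haw.symm (fun h => naw h.symm)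
  have e2 := dist_eq_two hX hwd hcd.symm hcw.symm (fun h => ncw h.symm)
  obtain ⟨s, hsa, hsc, hs⟩ := triangle_condition hX hac (e1.trans e2.symm)
  have hws : X.Adj w s := SimpleGraph.dist_eq_one_iff_adj.1 (by omega)
  have hbs : b ≠ s := by rintro rfl; exact nbc hsc
  have nbs : ¬ X.Adj b s := fun h =>
    nbc (adj_of_common_edge hX hsa hsc hac h.symm hab hbc.symm).symm
  have e3 := dist_le_of_adj hX hsa v
  have key := dist_of_square_of_not_lt hX hab hws.symm hsa.symm hwb.symm haw hbs naw nbs hv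
  have e4 := dist_le_of_adj hX hws.symm v
  have e5 : ¬ X.dist v s < X.dist v w := fun h => by
    have h1 := dist_le_of_adj hX hsc.symm v
    omega
  have := key e5
  omega

/-- The sectors delimited by the maximal clique containing a given edge. -/
def sectors (X : SimpleGraph V) (e : Sym2 V) : Set (Set V) :=
  {S | ∃ a b, e = s(a, b) ∧
    (S = closerSet X a b ∨ ∃ c, X.Adj c a ∧ X.Adj c b ∧ S = closerSet X c a)}

lemma mem_sectors (hX : IsQuasiMedian X) {a b : V} (hab : X.Adj a b) {S : Set V} :
    S ∈ sectors X s(a, b) ↔ S = closerSet X a b ∨ S = closerSet X b a ∨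
      ∃ c, X.Adj c a ∧ X.Adj c b ∧ S = closerSet X c a := by
  constructor
  · rintro ⟨a', b', he, h⟩
    rcases Sym2.eq_iff.1 he with ⟨rfl, rfl⟩ | ⟨rfl, rfl⟩
    · exact h.imp_right .inr
    · refine .inr (h.imp_right ?_)
      rintro ⟨c, h1, h2, rfl⟩
      exact ⟨c, h2, h1, closerSet_eq_of_triangle hX h1 h2 hab.symm⟩
  · rintro (rfl | rfl | h)
    · exact ⟨a, b, rfl, .inl rfl⟩
    · exact ⟨b, a, Sym2.eq_swap, .inl rfl⟩
    · exact ⟨a, b, rfl, .inr h⟩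

lemma sectors_subset_of_triangle (hX : IsQuasiMedian X) {a b c : V} (hab : X.Adj a b)
    (hac : X.Adj a c) (hbc : X.Adj b c) : sectors X s(a, b) ⊆ sectors X s(a, c) := by
  intro S hS
  rw [mem_sectors hX hac]
  rcases (mem_sectors hX hab).1 hS with rfl | rfl | ⟨d, hda, hdb, rfl⟩
  · exact .inl (closerSet_eq_of_triangle hX hab hac hbc)
  · exact .inr (.inr ⟨b, hab.symm, hbc, rfl⟩)
  · by_cases hdc : d = c
    · exact .inr (.inl (by rw [hdc]))
    · exact .inr (.inr ⟨d, hda, adj_of_common_edge hX hab hda.symm hdb.symm hac hbc hdc, rfl⟩)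

lemma sectors_eq_of_triangle (hX : IsQuasiMedian X) {a b c : V} (hab : X.Adj a b)
    (hac : X.Adj a c) (hbc : X.Adj b c) : sectors X s(a, b) = sectors X s(a, c) :=
  (sectors_subset_of_triangle hX hab hac hbc).antisymm
    (sectors_subset_of_triangle hX hac hab hbc.symm)

lemma closerSet_eq_of_square (hX : IsQuasiMedian X) {a b c d : V} (hab : X.Adj a b)
    (hcd : X.Adj c d) (hac : X.Adj a c) (hbd : X.Adj b d) (had : a ≠ d) (hbc : b ≠ c)
    (nad : ¬ X.Adj a d) (nbc : ¬ X.Adj b c) : closerSet X a b = closerSet X c d :=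
  (closerSet_subset_of_square hX hab hcd hac hbd had hbc nad nbc).antisymm
    (closerSet_subset_of_square hX hcd hab hac.symm hbd.symm hbc.symm had.symm
      (fun h => nbc h.symm) (fun h => nad h.symm))

lemma sectors_subset_of_square (hX : IsQuasiMedian X) {a b c d : V} (hab : X.Adj a b)
    (hcd : X.Adj c d) (hac : X.Adj a c) (hbd : X.Adj b d) (had : a ≠ d) (hbc : b ≠ c)
    (nad : ¬ X.Adj a d) (nbc : ¬ X.Adj b c) : sectors X s(a, b) ⊆ sectors X s(c, d) := by
  intro S hS
  rw [mem_sectors hX hcd]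
  rcases (mem_sectors hX hab).1 hS with rfl | rfl | ⟨x, hxa, hxb, rfl⟩
  · exact .inl (closerSet_eq_of_square hX hab hcd hac hbd had hbc nad nbc)
  · exact .inr (.inl (closerSet_eq_of_square hX hab.symm hcd.symm hbd hac hbc had nbc nad))
  · have hxc : x ≠ c := by rintro rfl; exact nbc hxb.symm
    have nxc : ¬ X.Adj x c := fun h =>
      nbc (adj_of_common_edge hX hxa h hac hxb hab hbc.symm).symm
    have hxd : x ≠ d := by rintro rfl; exact nad hxa.symm
    have nxd : ¬ X.Adj x d := fun h =>
      nad (adj_of_common_edge hX hxb h hbd hxa hab.symm had.symm).symm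
    have e1 := dist_eq_two hX hxa hac hxc nxc
    have e2 := dist_eq_two hX hxb hbd hxd nxd
    obtain ⟨y, hyc, hyd, hy⟩ := triangle_condition hX hcd (e1.trans e2.symm)
    have hxy : X.Adj x y := SimpleGraph.dist_eq_one_iff_adj.1 (by omega)
    have hay : a ≠ y := by rintro rfl; exact nad hyd
    have nay : ¬ X.Adj a y := fun h =>
      nad (adj_of_common_edge hX hyc hyd hcd h.symm hac.symm had.symm).symm
    exact .inr (.inr ⟨y, hyc, hyd,
      closerSet_eq_of_square hX hxa hyc hxy hac hxc hay nxc nay⟩)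

lemma sectors_eq_of_square (hX : IsQuasiMedian X) {a b c d : V} (hab : X.Adj a b)
    (hcd : X.Adj c d) (hac : X.Adj a c) (hbd : X.Adj b d) (had : a ≠ d) (hbc : b ≠ c) :
    sectors X s(a, b) = sectors X s(c, d) := by
  by_cases nad : X.Adj a d
  · rw [sectors_eq_of_triangle hX hab nad hbd, Sym2.eq_swap,
      sectors_eq_of_triangle hX nad.symm hcd.symm hac, Sym2.eq_swap]
  by_cases nbc : X.Adj b c
  · exact absurd (adj_of_common_edge hX nbc hab.symm hac.symm hbd hcd had) nad
  exact (sectors_subset_of_square hX hab hcd hac hbd had hbc nad nbc).antisymm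
    (sectors_subset_of_square hX hcd hab hac.symm hbd.symm hbc.symm had.symm
      (fun h => nbc h.symm) (fun h => nad h.symm))

lemma sectors_eq_of_eqvGen (hX : IsQuasiMedian X) {e f : Sym2 V}
    (h : Relation.EqvGen (SideRel X) e f) : sectors X e = sectors X f := by
  induction h with
  | rel e f h =>
    rcases h with ⟨a, b, c, hab, hac, hbc, rfl, rfl⟩ |
      ⟨a, b, c, d, hab, hcd, hac, hbd, had, hbc, rfl, rfl⟩
    · exact sectors_eq_of_triangle hX hab hac hbc
    · exact sectors_eq_of_square hX hab hcd hac hbd had hbc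
  | refl => rfl
  | symm _ _ _ ih => exact ih.symm
  | trans _ _ _ _ _ ih₁ ih₂ => exact ih₁.trans ih₂

lemma mem_edgeSet_iff_of_eqvGen {e f : Sym2 V} (h : Relation.EqvGen (SideRel X) e f) :
    e ∈ X.edgeSet ↔ f ∈ X.edgeSet := by
  induction h with
  | rel e f h =>
    rcases h with ⟨a, b, c, hab, hac, hbc, rfl, rfl⟩ |
      ⟨a, b, c, d, hab, hcd, hac, hbd, had, hbc, rfl, rfl⟩
    · exact iff_of_true hab hac
    · exact iff_of_true hab hcd
  | refl => rfl
  | symm _ _ _ ih => exact ih.symm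
  | trans _ _ _ _ _ ih₁ ih₂ => exact ih₁.trans ih₂

lemma sectors_disjoint (hX : IsQuasiMedian X) {a b v : V} (hab : X.Adj a b) {S T : Set V}
    (hS : S ∈ sectors X s(a, b)) (hT : T ∈ sectors X s(a, b)) (hvS : v ∈ S) (hvT : v ∈ T) :
    S = T := by
  have aux : ∀ c, X.Adj c a → X.Adj c b → v ∈ closerSet X c a →
      v ∉ closerSet X a b ∧ v ∉ closerSet X b a := by
    intro c hca hcb hv
    refine ⟨fun h => ?_, fun h => ?_⟩
    · exact not_mem_closerSet_swap hv (closerSet_subset_of_triangle hX hab hca.symm hcb.symm h)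
    · exact not_mem_closerSet_swap (closerSet_subset_of_triangle hX hca hcb hab hv)
        (closerSet_subset_of_triangle hX hab.symm hcb.symm hca.symm h)
  rcases (mem_sectors hX hab).1 hS with rfl | rfl | ⟨c, hca, hcb, rfl⟩ <;>
    rcases (mem_sectors hX hab).1 hT with rfl | rfl | ⟨d, hda, hdb, rfl⟩
  · rfl
  · exact absurd hvT (not_mem_closerSet_swap hvS)
  · exact absurd hvS (aux d hda hdb hvT).1
  · exact absurd hvT (not_mem_closerSet_swap hvS)
  · rfl
  · exact absurd hvS (aux d hda hdb hvT).2
  · exact absurd hvT (aux c hca hcb hvS).1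
  · exact absurd hvT (aux c hca hcb hvS).2
  · by_cases hcd : c = d
    · rw [hcd]
    have hadj := adj_of_common_edge hX hab hca.symm hcb.symm hda.symm hdb.symm hcd
    exact absurd (closerSet_subset_of_triangle hX hda hadj.symm hca.symm hvT)
      (not_mem_closerSet_swap (closerSet_subset_of_triangle hX hca hadj hda.symm hvS))

namespace Hyperplane

lemma adj_of_mem (H : Hyperplane X) {a b : V} (h : s(a, b) ∈ H.1) : X.Adj a b := by
  obtain ⟨_, e, he, rfl⟩ := H
  exact (mem_edgeSet_iff_of_eqvGen h).1 he

lemma eqvGen_of_mem (H : Hyperplane X) {e f : Sym2 V} (he : e ∈ H.1) (hf : f ∈ H.1) :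
    Relation.EqvGen (SideRel X) e f := by
  obtain ⟨_, g, hg, rfl⟩ := H
  exact (Relation.EqvGen.symm _ _ he).trans _ _ _ hf

lemma mem_of_eqvGen (H : Hyperplane X) {e f : Sym2 V} (he : e ∈ H.1)
    (h : Relation.EqvGen (SideRel X) e f) : f ∈ H.1 := by
  obtain ⟨_, g, hg, rfl⟩ := H
  exact Relation.EqvGen.trans _ _ _ he h

lemma eq_of_mem {H K : Hyperplane X} {e : Sym2 V} (h : e ∈ H.1) (k : e ∈ K.1) : H = K :=
  Subtype.ext (Set.ext fun _ => ⟨fun hf => K.mem_of_eqvGen k (H.eqvGen_of_mem h hf),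
    fun hf => H.mem_of_eqvGen h (K.eqvGen_of_mem k hf)⟩)

/-- The hyperplane dual to an edge. -/
def ofAdj {a b : V} (h : X.Adj a b) : Hyperplane X :=
  ⟨hypClass X s(a, b), s(a, b), h, rfl⟩

lemma mem_ofAdj {a b : V} (h : X.Adj a b) : s(a, b) ∈ (ofAdj h).1 := Relation.EqvGen.refl _

lemma mem_of_triangle (H : Hyperplane X) {a b c : V} (h : s(a, b) ∈ H.1) (hac : X.Adj a c)
    (hbc : X.Adj b c) : s(a, c) ∈ H.1 :=
  H.mem_of_eqvGen h (.rel _ _ (.inl ⟨a, b, c, H.adj_of_mem h, hac, hbc, rfl, rfl⟩))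

lemma mem_of_square (H : Hyperplane X) {a b c d : V} (h : s(a, b) ∈ H.1) (hcd : X.Adj c d)
    (hac : X.Adj a c) (hbd : X.Adj b d) (had : a ≠ d) (hbc : b ≠ c) : s(c, d) ∈ H.1 :=
  H.mem_of_eqvGen h
    (.rel _ _ (.inr ⟨a, b, c, d, H.adj_of_mem h, hcd, hac, hbd, had, hbc, rfl, rfl⟩))

/-- Two vertices lie in different sectors of the hyperplane `H`. -/
def Sep (H : Hyperplane X) (v w : V) : Prop :=
  ∃ a b, s(a, b) ∈ H.1 ∧ v ∈ closerSet X a b ∧ w ∈ closerSet X b a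

lemma Sep.symm {H : Hyperplane X} {v w : V} (h : H.Sep v w) : H.Sep w v := by
  obtain ⟨a, b, h, hv, hw⟩ := h
  exact ⟨b, a, Sym2.eq_swap ▸ h, hw, hv⟩

/-- The endpoints of an edge of `H` are not both closer to `t` than to `s`, if `s t` is in `H`. -/
lemma not_mem_closerSet_of_mem (hX : IsQuasiMedian X) (H : Hyperplane X) {s t p q : V}
    (hst : s(s, t) ∈ H.1) (hpq : s(p, q) ∈ H.1) (hp : p ∈ closerSet X t s) :
    q ∉ closerSet X t s := by
  intro hq
  have had := H.adj_of_mem hst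
  have hadj := H.adj_of_mem hpq
  have heq := sectors_eq_of_eqvGen hX (H.eqvGen_of_mem hpq hst)
  have h0 := (mem_sectors hX had).2 (.inr (.inl rfl))
  have h1 := heq ▸ (mem_sectors hX hadj).2 (.inl rfl)
  have h2 := heq ▸ (mem_sectors hX hadj).2 (.inr (.inl rfl))
  have e1 := sectors_disjoint hX had h0 h1 hp (left_mem_closerSet hadj)
  have e2 := sectors_disjoint hX had h0 h2 hq (left_mem_closerSet hadj.symm)
  have : p ∈ closerSet X q p := (e1.symm.trans e2) ▸ left_mem_closerSet hadj
  exact not_mem_closerSet_swap this (left_mem_closerSet hadj)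

lemma not_sep_self (H : Hyperplane X) (v : V) : ¬ H.Sep v v := by
  rintro ⟨a, b, -, h1, h2⟩
  exact not_mem_closerSet_swap h1 h2

lemma sep_of_mem (H : Hyperplane X) {v w : V} (h : s(v, w) ∈ H.1) : H.Sep v w :=
  ⟨v, w, h, left_mem_closerSet (H.adj_of_mem h), left_mem_closerSet (H.adj_of_mem h).symm⟩

lemma Sep.cotrans (hX : IsQuasiMedian X) {H : Hyperplane X} {v w : V} (h : H.Sep v w) (u : V) :
    H.Sep v u ∨ H.Sep u w := by
  obtain ⟨a, b, h, hv, hw⟩ := h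
  rcases lt_trichotomy (X.dist u a) (X.dist u b) with hu | hu | hu
  · exact .inr ⟨a, b, h, hu, hw⟩
  · have hab := H.adj_of_mem h
    obtain ⟨c, hca, hcb, hc⟩ := triangle_condition hX hab hu
    refine .inl ⟨a, c, H.mem_of_triangle h hca.symm hcb.symm,
      closerSet_subset_of_triangle hX hab hca.symm hcb.symm hv, ?_⟩
    rw [mem_closerSet]
    omega
  · exact .inl ⟨a, b, h, hv, hu⟩

/-- An edge between different sectors of `H` is dual to `H`. -/
lemma mem_of_sep (hX : IsQuasiMedian X) (H : Hyperplane X) {v w : V} (hvw : X.Adj v w)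
    (h : H.Sep v w) : s(v, w) ∈ H.1 := by
  obtain ⟨a, b, h, hv, hw⟩ := h
  obtain ⟨k, hk⟩ : ∃ k, X.dist v a = k := ⟨_, rfl⟩
  induction k generalizing a b with
  | zero =>
    have hab := H.adj_of_mem h
    have h1 := dist_add_one_of_mem_closerSet hX hab.symm hw
    obtain rfl := hX.connected.dist_eq_zero_iff.1 hk
    have h2 := SimpleGraph.dist_eq_one_iff_adj.2 hvw.symm
    obtain rfl := hX.connected.dist_eq_zero_iff.1 (show X.dist w b = 0 by omega)
    exact h
  | succ k ih =>
    have hab := H.adj_of_mem h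
    have h1 := dist_add_one_of_mem_closerSet hX hab.symm hw
    have h2 := dist_add_one_of_mem_closerSet hX hab hv
    have step : ∀ c, X.dist v c ≤ X.dist w c + 1 ∧ X.dist w c ≤ X.dist v c + 1 := by
      intro c
      rw [X.dist_comm (u := v), X.dist_comm (u := w)]
      exact ⟨dist_le_of_adj hX hvw c, dist_le_of_adj hX hvw.symm c⟩
    have sa := step a
    have sb := step b
    obtain ⟨a', haa, ha'⟩ := exists_adj_closer hX (p := a) (q := v)
      (by rintro rfl; simp at hk)
    rw [X.dist_comm, X.dist_comm (u := a)] at ha'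
    have sa' := step a'
    have e1 := dist_le_of_adj hX haa w
    have hne : a' ≠ b := by rintro rfl; omega
    have nadj : ¬ X.Adj a' b := fun h' => by
      have := dist_le_of_adj hX h'.symm v
      omega
    obtain ⟨z, hza, hzb, hz⟩ := quadrangle_condition hX (v := w) (k := k + 1) haa hab hne nadj
      (by omega) (by omega) (by omega)
    have sz := step z
    have e2 := dist_le_of_adj hX hzb.symm v
    refine ih a' z (H.mem_of_square h hza.symm haa hzb.symm ?_ hne.symm) ?_ ?_ (by omega)
    · rintro rfl; omega
    · rw [mem_closerSet]; omega
    · rw [mem_closerSet]; omega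

/-- Edges of a geodesic are dual to hyperplanes separating its endpoints. -/
lemma sep_of_geodesic (hX : IsQuasiMedian X) (H : Hyperplane X) {p q s t : V}
    (h : s(s, t) ∈ H.1) (hd : X.dist p s + 1 + X.dist t q = X.dist p q) : H.Sep p q := by
  have h1 := hX.connected.dist_triangle (u := p) (v := t) (w := q)
  have h2 := hX.connected.dist_triangle (u := p) (v := s) (w := q)
  refine ⟨s, t, h, ?_, ?_⟩
  · rw [mem_closerSet]; omega
  · rw [mem_closerSet, X.dist_comm, X.dist_comm (u := q)]; omega

/-- A geodesic between vertices in different sectors of `H` has an edge dual to `H`. -/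
lemma Sep.exists_edge (hX : IsQuasiMedian X) {H : Hyperplane X} {p q : V} (h : H.Sep p q) :
    ∃ s t, s(s, t) ∈ H.1 ∧ X.dist p s + 1 + X.dist t q = X.dist p q := by
  obtain ⟨n, hn⟩ : ∃ n, X.dist p q = n := ⟨_, rfl⟩
  induction n generalizing p with
  | zero =>
    obtain rfl := hX.connected.dist_eq_zero_iff.1 hn
    exact absurd h (H.not_sep_self p)
  | succ n ih =>
    obtain ⟨p', hpp, hp'⟩ := exists_adj_closer hX (p := p) (q := q)
      (by rintro rfl; simp at hn)
    rcases h.cotrans hX p' with h | h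
    · refine ⟨p, p', H.mem_of_sep hX hpp h, ?_⟩
      rw [SimpleGraph.dist_self]
      omega
    · obtain ⟨s, t, hst, hd⟩ := ih h (by omega)
      refine ⟨s, t, hst, ?_⟩
      have h1 := hX.connected.dist_triangle (u := p) (v := p') (w := s)
      have h2 := hX.connected.dist_triangle (u := p) (v := s) (w := q)
      have h3 := hX.connected.dist_triangle (u := s) (v := t) (w := q)
      rw [SimpleGraph.dist_eq_one_iff_adj.2 hpp] at h1
      rw [SimpleGraph.dist_eq_one_iff_adj.2 (H.adj_of_mem hst)] at h3
      omega

/-- A geodesic crosses each hyperplane at most once. -/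
lemma Sep.not_sep_of_geodesic (hX : IsQuasiMedian X) {H : Hyperplane X} {y x u : V}
    (h : H.Sep y x) (hd : X.dist y x + X.dist x u = X.dist y u) : ¬ H.Sep x u := by
  intro h'
  obtain ⟨s, t, hst, e⟩ := h.exists_edge hX
  obtain ⟨s', t', hst', e'⟩ := h'.exists_edge hX
  have tri : ∀ a b c : V, X.dist a c ≤ X.dist a b + X.dist b c :=
    fun a b c => hX.connected.dist_triangle
  have o := SimpleGraph.dist_eq_one_iff_adj.2 (H.adj_of_mem hst)
  have o' := SimpleGraph.dist_eq_one_iff_adj.2 (H.adj_of_mem hst')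
  refine H.not_mem_closerSet_of_mem hX hst hst' ?_ ?_
  · rw [mem_closerSet, X.dist_comm, X.dist_comm (u := s')]
    have := tri t x s'
    have := tri y s u
    have := tri s s' u
    have := tri s' t' u
    omega
  · rw [mem_closerSet, X.dist_comm, X.dist_comm (u := t')]
    have := tri t x t'
    have := tri x s' t'
    have := tri y s u
    have := tri s t' u
    omega

lemma separates_iff_sep (hX : IsQuasiMedian X) (H : Hyperplane X) {p q : V} :
    Separates X H.1 p q ↔ H.Sep p q := by
  constructor
  · intro h
    by_contra hn
    obtain ⟨n, hn'⟩ : ∃ n, X.dist p q = n := ⟨_, rfl⟩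
    have : ∃ w : X.Walk p q, ∀ e ∈ w.edges, e ∉ H.1 := by
      clear h
      induction n generalizing p with
      | zero =>
        obtain rfl := hX.connected.dist_eq_zero_iff.1 hn'
        exact ⟨.nil, by simp⟩
      | succ n ih =>
        obtain ⟨p', hpp, hp'⟩ := exists_adj_closer hX (p := p) (q := q)
          (by rintro rfl; simp at hn')
        have hp : s(p, p') ∉ H.1 := fun h => hn (H.sep_of_geodesic hX h (by
          rw [SimpleGraph.dist_self]
          omega))
        obtain ⟨w, hw⟩ := ih (p := p') (fun h => (h.cotrans hX p).elim
          (fun h => hp (H.mem_of_sep hX hpp h.symm)) hn) (by omega)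
        refine ⟨.cons hpp w, fun e he => ?_⟩
        rw [SimpleGraph.Walk.edges_cons, List.mem_cons] at he
        rcases he with rfl | he
        exacts [hp, hw e he]
    obtain ⟨w, hw⟩ := this
    obtain ⟨e, he, heH⟩ := h w
    exact hw e he heH
  · intro h w
    induction w with
    | nil => exact absurd h (H.not_sep_self _)
    | @cons p p' q hadj w ih =>
      rcases h.cotrans hX p' with h | h
      · exact ⟨s(p, p'), by simp, H.mem_of_sep hX hadj h⟩
      · obtain ⟨e, he, heH⟩ := ih h
        exact ⟨e, by simp [he], heH⟩

/-- Among vertices adjacent to `y` along `H`, one lies in the sector of `x'`. -/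
lemma exists_mem_of_not_sep (hX : IsQuasiMedian X) (H : Hyperplane X) {x x' y : V}
    (hxx : s(x, x') ∈ H.1) (hy : y ∈ hypCarrier X H) (hxy : ¬ H.Sep x y) :
    ∃ y', s(y, y') ∈ H.1 ∧ X.dist y x' = X.dist y x + 1 ∧ X.dist y' x' = X.dist y x := by
  have key : ∀ p p' q : V, s(p, p') ∈ H.1 → ¬ H.Sep p q → q ∈ closerSet X p p' := by
    intro p p' q h hpq
    have hpp := H.adj_of_mem h
    rcases lt_trichotomy (X.dist q p) (X.dist q p') with hq | hq | hq
    · exact hq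
    · obtain ⟨c, hcp, hcp', hc⟩ := triangle_condition hX hpp hq
      refine absurd ⟨p, c, H.mem_of_triangle h hcp.symm hcp'.symm, left_mem_closerSet hcp.symm, ?_⟩
        hpq
      rw [mem_closerSet]
      omega
    · exact absurd ⟨p, p', h, left_mem_closerSet hpp, hq⟩ hpq
  obtain ⟨e, he, hye⟩ := hy
  obtain ⟨y₁, rfl⟩ := Sym2.mem_iff_exists.1 hye
  have hyx : ¬ H.Sep y x := fun h => hxy h.symm
  have hx' := H.not_mem_closerSet_of_mem hX (Sym2.eq_swap ▸ he : s(y₁, y) ∈ H.1) hxx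
    (key y y₁ x he hyx)
  obtain ⟨y', hy', hx''⟩ : ∃ y', s(y, y') ∈ H.1 ∧ x' ∈ closerSet X y' y := by
    rw [mem_closerSet, not_lt] at hx'
    rcases hx'.lt_or_eq with h | h
    · exact ⟨y₁, he, h⟩
    · obtain ⟨c, hcy₁, hcy, hc⟩ := triangle_condition hX (H.adj_of_mem he).symm h
      exact ⟨c, H.mem_of_triangle he hcy.symm hcy₁.symm, by rw [mem_closerSet]; omega⟩
  have e1 := dist_add_one_of_mem_closerSet hX (H.adj_of_mem hxx) (key x x' y hxx hxy)
  have e2 := dist_add_one_of_mem_closerSet hX (H.adj_of_mem hy').symm hx''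
  have c1 := X.dist_comm (u := x') (v := y)
  have c2 := X.dist_comm (u := x') (v := y')
  exact ⟨y', hy', by omega, by omega⟩

lemma left_mem_hypCarrier {H : Hyperplane X} {a b : V} (h : s(a, b) ∈ H.1) :
    a ∈ hypCarrier X H := ⟨_, h, by simp⟩

lemma right_mem_hypCarrier {H : Hyperplane X} {a b : V} (h : s(a, b) ∈ H.1) :
    b ∈ hypCarrier X H := ⟨_, h, by simp⟩

lemma hypCarrier_nonempty (H : Hyperplane X) : (hypCarrier X H).Nonempty := by
  obtain ⟨e, -, h⟩ := H.2
  exact ⟨e.out.1, e, h ▸ Relation.EqvGen.refl e, Sym2.out_fst_mem e⟩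

/-- A vertex with two neighbours in a carrier belongs to it. -/
lemma mem_hypCarrier_of_adj (hX : IsQuasiMedian X) (H : Hyperplane X) {x y z : V}
    (hx : x ∈ hypCarrier X H) (hy : y ∈ hypCarrier X H) (hne : x ≠ y) (hzx : X.Adj z x)
    (hzy : X.Adj z y) : z ∈ hypCarrier X H := by
  by_contra hz
  have crossing : ∀ t, X.Adj z t → ¬ H.Sep z t := fun t h hs =>
    hz (left_mem_hypCarrier (H.mem_of_sep hX h hs))
  have hxy : ¬ H.Sep x y := fun h => (h.cotrans hX z).elim
    (fun h => crossing x hzx h.symm) (crossing y hzy)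
  obtain ⟨e, he, hxe⟩ := hx
  obtain ⟨x', rfl⟩ := Sym2.mem_iff_exists.1 hxe
  obtain ⟨y', hyy, hd1, hd2⟩ := H.exists_mem_of_not_sep hX he hy hxy
  have hzx' : H.Sep z x' := ((H.sep_of_mem he).cotrans hX z).resolve_left
    (fun h => crossing x hzx h.symm)
  have far : ∀ t, H.Sep z t → ¬ X.Adj z t := fun t h h' => crossing t h' h
  have sector : ∀ t, ¬ H.Sep x' t → H.Sep z t := fun t ht =>
    (hzx'.cotrans hX t).resolve_right (fun h => ht h.symm)
  have hx'y' : ¬ H.Sep x' y' := by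
    intro h
    have hyy' := H.sep_of_mem hyy
    refine Sep.not_sep_of_geodesic hX hyy' ?_ h.symm
    rw [SimpleGraph.dist_eq_one_iff_adj.2 (H.adj_of_mem hyy)]
    omega
  have hzy' := sector y' hx'y'
  have dist_two : ∀ {s t}, X.Adj z s → X.Adj s t → H.Sep z t → X.dist z t = 2 := by
    intro s t hzs hst h
    refine dist_eq_two hX hzs hst ?_ (far t h)
    rintro rfl
    exact H.not_sep_self _ h
  have dx := dist_two hzx (H.adj_of_mem he) hzx'
  have dy := dist_two hzy (H.adj_of_mem hyy) hzy'
  have hne' : x' ≠ y' := by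
    rintro rfl
    rw [SimpleGraph.dist_self] at hd2
    exact hne (hX.connected.dist_eq_zero_iff.1 hd2.symm).symm
  have close : ∀ {t s}, X.Adj t s → X.dist z t + 1 = X.dist z s → X.dist z s = 2 → X.Adj z t :=
    fun _ h h' => SimpleGraph.dist_eq_one_iff_adj.1 (by omega)
  have equidistant : ∀ {s t}, X.Adj s t → H.Sep z s → ¬ H.Sep s t → X.dist z s = X.dist z t →
      X.dist z s = 2 → False := by
    intro s t hst hzs hst' hd h2
    obtain ⟨c, hcs, hct, hc⟩ := triangle_condition hX hst hd
    have hzc := close hcs hc h2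
    have hsc : H.Sep c s := (hzs.cotrans hX c).resolve_left (crossing c hzc)
    exact hst' (H.sep_of_mem (H.mem_of_triangle (Sym2.eq_swap ▸ H.mem_of_sep hX hcs hsc) hst hct))
  by_cases hadj : X.Adj x' y'
  · exact equidistant hadj hzx' hx'y' (dx.trans dy.symm) dx
  have nadj : ¬ X.Adj y x := by
    intro h
    rw [SimpleGraph.dist_eq_one_iff_adj.2 h] at hd2
    exact hadj (SimpleGraph.dist_eq_one_iff_adj.1 hd2).symm
  have d2 : X.dist y x = 2 := dist_eq_two hX hzy.symm hzx hne.symm nadj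
  obtain ⟨c, hxc, hc⟩ := exists_adj_closer hX hne'
  have hcy : X.Adj c y' := SimpleGraph.dist_eq_one_iff_adj.1 (by
    rw [X.dist_comm (u := x')] at hc
    omega)
  have between : ∀ t, X.Adj x' t → X.Adj t y' → ¬ H.Sep x' t := by
    intro t h1 h2 h
    have h3 := SimpleGraph.dist_eq_one_iff_adj.2 h1
    have h4 := SimpleGraph.dist_eq_one_iff_adj.2 h2
    refine Sep.not_sep_of_geodesic hX h (u := y') ?_ ?_
    · rw [X.dist_comm (u := x') (v := y')]
      omega
    · exact (h.symm.cotrans hX y').resolve_right fun h' => hx'y' h'.symm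
  have hxc' := between c hxc hcy
  have hzc := sector c hxc'
  have l1 := dist_le_of_adj hX hxc z
  have l2 := dist_le_of_adj hX hxc.symm z
  have l3 : X.dist z c ≠ 1 := fun h => far c hzc (SimpleGraph.dist_eq_one_iff_adj.1 h)
  rcases (show X.dist z c = 2 ∨ X.dist z c = 3 by omega) with h | h
  · exact equidistant hxc hzx' hxc' (dx.trans h.symm) dx
  · obtain ⟨t, htx, hty, ht⟩ := quadrangle_condition hX hxc.symm hcy hne' hadj h dx dy
    exact far t (sector t (between t htx.symm hty))
      (SimpleGraph.dist_eq_one_iff_adj.1 (by omega))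

/-- A property of vertices of a carrier that passes to neighbours passes to the whole carrier. -/
lemma hypCarrier_induction (H : Hyperplane X) (Q : V → Prop)
    (hQ : ∀ s t, s ∈ hypCarrier X H → t ∈ hypCarrier X H → X.Adj s t → Q s → Q t) {p q : V}
    (hp : p ∈ hypCarrier X H) (hq : q ∈ hypCarrier X H) (h : Q p) : Q q := by
  have edge : ∀ e ∈ H.1, (∃ s ∈ e, Q s) → ∀ t ∈ e, Q t := by
    rintro e he ⟨s, hs, hQs⟩ t ht
    by_cases hst : s = t
    · exact hst ▸ hQs
    obtain rfl := (Sym2.mem_and_mem_iff hst).1 ⟨hs, ht⟩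
    exact hQ s t (left_mem_hypCarrier he) (right_mem_hypCarrier he) (H.adj_of_mem he) hQs
  have key : ∀ e f, Relation.EqvGen (SideRel X) e f → e ∈ H.1 →
      ((∃ s ∈ e, Q s) ↔ (∃ s ∈ f, Q s)) := by
    intro e f hef
    induction hef with
    | rel e f hs =>
      intro he
      have hf := H.mem_of_eqvGen he (.rel _ _ hs)
      rcases hs with ⟨a, b, c, hab, hac, hbc, rfl, rfl⟩ |
        ⟨a, b, c, d, hab, hcd, hac, hbd, had, hbc, rfl, rfl⟩
      · exact ⟨fun h => ⟨a, by simp, edge _ he h a (by simp)⟩,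
          fun h => ⟨a, by simp, edge _ hf h a (by simp)⟩⟩
      · exact ⟨fun h => ⟨c, by simp, hQ a c (left_mem_hypCarrier he) (left_mem_hypCarrier hf) hac
            (edge _ he h a (by simp))⟩,
          fun h => ⟨a, by simp, hQ c a (left_mem_hypCarrier hf) (left_mem_hypCarrier he) hac.symm
            (edge _ hf h c (by simp))⟩⟩
    | refl => exact fun _ => Iff.rfl
    | symm e f h ih => exact fun he => (ih (H.mem_of_eqvGen he (.symm _ _ h))).symm
    | trans e f g h₁ h₂ ih₁ ih₂ =>
      exact fun he => (ih₁ he).trans (ih₂ (H.mem_of_eqvGen he h₁))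
  obtain ⟨e, he, hpe⟩ := hp
  obtain ⟨f, hf, hqf⟩ := hq
  exact edge f hf ((key e f (H.eqvGen_of_mem he hf) he).1 ⟨p, hpe, h⟩) q hqf

/-- Carriers are gated. -/
lemma exists_gate (hX : IsQuasiMedian X) (H : Hyperplane X) (v : V) :
    ∃ p ∈ hypCarrier X H, ∀ q ∈ hypCarrier X H, X.dist v p + X.dist p q = X.dist v q := by
  have hne : ∃ n, ∃ p ∈ hypCarrier X H, X.dist v p = n := by
    obtain ⟨p, hp⟩ := H.hypCarrier_nonempty
    exact ⟨_, p, hp, rfl⟩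
  classical
  obtain ⟨p, hp, hmin⟩ : ∃ p ∈ hypCarrier X H, ∀ q ∈ hypCarrier X H, X.dist v p ≤ X.dist v q := by
    obtain ⟨p, hp, hpn⟩ := Nat.find_spec hne
    exact ⟨p, hp, fun q hq => hpn ▸ Nat.find_min' hne ⟨q, hq, rfl⟩⟩
  obtain ⟨R, hR0, hR⟩ : ∃ R : ℕ → V → Prop, (∀ q, R 0 q ↔ q = p) ∧
      ∀ n q, R (n + 1) q ↔ q ∈ hypCarrier X H ∧ ∃ s, X.Adj s q ∧ R n s :=
    ⟨fun n => n.rec (fun q => q = p) fun _ P q => q ∈ hypCarrier X H ∧ ∃ s, X.Adj s q ∧ P s,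
      fun _ => Iff.rfl, fun _ _ => Iff.rfl⟩
  have Rmem : ∀ n q, R n q → q ∈ hypCarrier X H := by
    rintro (_ | n) q h
    · exact (hR0 q).1 h ▸ hp
    · exact ((hR n q).1 h).1
  have Rdist : ∀ n q, R n q → X.dist p q ≤ n := by
    intro n
    induction n with
    | zero => intro q h; simp [(hR0 q).1 h]
    | succ n ih =>
      intro q h
      obtain ⟨-, s, hsq, hs⟩ := (hR n q).1 h
      have := ih s hs
      have := dist_le_of_adj hX hsq.symm p
      omega
  have down : ∀ n s z, R n s → X.dist v s = X.dist v p + n → z ∈ hypCarrier X H → X.Adj s z →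
      X.dist v z + 1 = X.dist v s → ∃ m, R m z ∧ X.dist v z = X.dist v p + m := by
    intro n
    induction n with
    | zero =>
      intro s z _ hd hz _ hvz
      have := hmin z hz
      omega
    | succ n ih =>
      intro s z h hd hz hsz hvz
      obtain ⟨hs, t, hts, ht⟩ := (hR n s).1 h
      have b1 := Rdist n t ht
      have b2 := hX.connected.dist_triangle (u := v) (v := p) (w := t)
      have b3 := dist_le_of_adj hX hts.symm v
      have hvt : X.dist v t = X.dist v p + n := by omega
      by_cases htz : t = z
      · exact ⟨n, htz ▸ ht, htz ▸ hvt⟩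
      obtain ⟨w, hwt, hwz, hw⟩ : ∃ w, X.Adj w t ∧ X.Adj w z ∧ X.dist v w + 1 = X.dist v t := by
        by_cases hadj : X.Adj t z
        · exact triangle_condition hX hadj (by omega)
        · exact quadrangle_condition hX hts.symm hsz htz hadj (by omega) rfl (by omega)
      have hwH := H.mem_hypCarrier_of_adj hX (Rmem n t ht) hz htz hwt hwz
      obtain ⟨m, hm, hwm⟩ := ih t w ht hvt hwH hwt.symm hw
      exact ⟨m + 1, (hR m z).2 ⟨hz, w, hwz, hm⟩, by omega⟩
  refine ⟨p, hp, fun q hq => ?_⟩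
  obtain ⟨m, hm, hqm⟩ : ∃ m, R m q ∧ X.dist v q = X.dist v p + m := by
    refine H.hypCarrier_induction (fun q => ∃ m, R m q ∧ X.dist v q = X.dist v p + m) ?_ hp hq
      ⟨0, (hR0 p).2 rfl, rfl⟩
    rintro s t hs ht hst ⟨m, hm, hd⟩
    have l1 := dist_le_of_adj hX hst v
    have l2 := dist_le_of_adj hX hst.symm v
    rcases (show X.dist v t + 1 = X.dist v s ∨ X.dist v t = X.dist v s ∨
      X.dist v t = X.dist v s + 1 by omega) with h | h | h
    · exact down m s t hm hd ht hst h
    · obtain ⟨z, hzs, hzt, hz⟩ := triangle_condition hX hst h.symm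
      have hzH := H.mem_hypCarrier_of_adj hX hs ht hst.ne hzs hzt
      obtain ⟨k, hk, hzk⟩ := down m s z hm hd hzH hzs.symm hz
      exact ⟨k + 1, (hR k t).2 ⟨ht, z, hzt, hk⟩, by omega⟩
    · exact ⟨m + 1, (hR m t).2 ⟨ht, s, hst, hm⟩, by omega⟩
  have := Rdist m q hm
  have := hX.connected.dist_triangle (u := v) (v := p) (w := q)
  omega

/-- Carriers are convex. -/
lemma mem_hypCarrier_of_geodesic (hX : IsQuasiMedian X) (H : Hyperplane X) {u w z : V}
    (hu : u ∈ hypCarrier X H) (hw : w ∈ hypCarrier X H)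
    (hz : X.dist u z + X.dist z w = X.dist u w) : z ∈ hypCarrier X H := by
  obtain ⟨p, hp, hgate⟩ := H.exists_gate hX z
  have h1 := hgate u hu
  have h2 := hgate w hw
  have h3 := hX.connected.dist_triangle (u := u) (v := p) (w := w)
  have h4 := X.dist_comm (u := z) (v := u)
  have h5 := X.dist_comm (u := p) (v := u)
  obtain rfl := hX.connected.dist_eq_zero_iff.1 (show X.dist z p = 0 by omega)
  exact hp

end Hyperplane

lemma exists_mem_hypCarrier_of_contact {H K : Hyperplane X} (h : (contactGraph X).Adj H K) :
    ∃ p, p ∈ hypCarrier X H ∧ p ∈ hypCarrier X K := by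
  obtain ⟨-, (⟨p, e, he, f, hf, a, b, rfl, rfl, -⟩ | ⟨p, e, he, f, hf, a, b, rfl, rfl, -⟩) |
    (⟨p, e, he, f, hf, a, b, rfl, rfl, -⟩ | ⟨p, e, he, f, hf, a, b, rfl, rfl, -⟩)⟩ := h <;>
  exact ⟨p, ⟨_, by assumption, by simp⟩, ⟨_, by assumption, by simp⟩⟩

lemma eq_or_contact_of_mem_hypCarrier {H K : Hyperplane X} {p : V} (hp : p ∈ hypCarrier X H)
    (hp' : p ∈ hypCarrier X K) : H = K ∨ (contactGraph X).Adj H K := by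
  obtain ⟨e, he, hpe⟩ := hp
  obtain ⟨f, hf, hpf⟩ := hp'
  obtain ⟨a, rfl⟩ := Sym2.mem_iff_exists.1 hpe
  obtain ⟨b, rfl⟩ := Sym2.mem_iff_exists.1 hpf
  by_cases hHK : H = K
  · exact .inl hHK
  have ha := H.adj_of_mem he
  have hb := K.adj_of_mem hf
  have hab : a ≠ b := by
    rintro rfl
    exact hHK (Hyperplane.eq_of_mem he hf)
  have nab : ¬ X.Adj a b := fun h =>
    hHK (Hyperplane.eq_of_mem (H.mem_of_triangle he hb h) hf)
  refine .inr ⟨hHK, .inl ?_⟩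
  by_cases hq : ∃ q : V, q ≠ p ∧ X.Adj a q ∧ X.Adj b q
  · exact .inl ⟨p, _, he, _, hf, a, b, rfl, rfl, ha, hb, hab, nab, hq⟩
  · exact .inr ⟨p, _, he, _, hf, a, b, rfl, rfl, ha, hb, hab, nab, hq⟩

lemma contactGraph_dist_le_one {H K : Hyperplane X} {p : V} (hp : p ∈ hypCarrier X H)
    (hp' : p ∈ hypCarrier X K) : (contactGraph X).dist H K ≤ 1 := by
  rcases eq_or_contact_of_mem_hypCarrier hp hp' with rfl | h
  · simp
  · exact (SimpleGraph.dist_eq_one_iff_adj.2 h).le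

lemma contactGraph_reachable (hX : IsQuasiMedian X) (H K : Hyperplane X) :
    (contactGraph X).Reachable H K := by
  have meet : ∀ {H K : Hyperplane X} {p : V}, p ∈ hypCarrier X H → p ∈ hypCarrier X K →
      (contactGraph X).Reachable H K := fun hp hp' =>
    (eq_or_contact_of_mem_hypCarrier hp hp').elim (fun h => h ▸ .refl _) (fun h => h.reachable)
  obtain ⟨p, hp⟩ := H.hypCarrier_nonempty
  obtain ⟨q, hq⟩ := K.hypCarrier_nonempty
  obtain ⟨w⟩ := hX.connected p q
  induction w generalizing H with
  | nil => exact meet hp hq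
  | cons h w ih =>
    have hm := Hyperplane.mem_ofAdj h
    exact (meet hp (Hyperplane.left_mem_hypCarrier hm)).trans
      (ih _ (Hyperplane.right_mem_hypCarrier hm) hq)

lemma contactGraph_connected (hX : IsQuasiMedian X) (A : Hyperplane X) :
    (contactGraph X).Connected :=
  have : Nonempty (Hyperplane X) := ⟨A⟩
  ⟨contactGraph_reachable hX⟩

/-- Along a geodesic, distances are differences of indices. -/
lemma dist_of_geodesic {W : Type*} {G : SimpleGraph W} (hG : G.Connected) {n : ℕ} {g : ℕ → W}
    (hadj : ∀ j < n, G.Adj (g j) (g (j + 1))) (hn : G.dist (g 0) (g n) = n) {i j : ℕ}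
    (hij : i ≤ j) (hj : j ≤ n) : G.dist (g i) (g j) = j - i := by
  have upper : ∀ i k, i + k ≤ n → G.dist (g i) (g (i + k)) ≤ k := by
    intro i k
    induction k with
    | zero => simp
    | succ k ih =>
      intro h
      have h1 := ih (by omega)
      have h2 := hG.dist_triangle (u := g i) (v := g (i + k)) (w := g (i + (k + 1)))
      have h3 := SimpleGraph.dist_eq_one_iff_adj.2 (hadj (i + k) (by omega))
      rw [add_assoc] at h3
      omega
  have u1 := upper 0 i (by omega)
  have u2 := upper i (j - i) (by omega)
  have u3 := upper j (n - j) (by omega)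
  rw [Nat.zero_add] at u1
  rw [Nat.add_sub_cancel' hij] at u2
  rw [Nat.add_sub_cancel' hj] at u3
  have t1 := hG.dist_triangle (u := g 0) (v := g i) (w := g n)
  have t2 := hG.dist_triangle (u := g i) (v := g j) (w := g n)
  omega

/-- A hyperplane crossing a carrier is at distance at most `1` from its hyperplane. -/
lemma contactGraph_dist_le_one_of_sep (hX : IsQuasiMedian X) {H K : Hyperplane X} {u w : V}
    (hu : u ∈ hypCarrier X H) (hw : w ∈ hypCarrier X H) (h : K.Sep u w) :
    (contactGraph X).dist K H ≤ 1 := by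
  obtain ⟨s, t, hst, hd⟩ := h.exists_edge hX
  refine contactGraph_dist_le_one (Hyperplane.left_mem_hypCarrier hst)
    (H.mem_hypCarrier_of_geodesic hX hu hw ?_)
  have h1 := hX.connected.dist_triangle (u := u) (v := s) (w := w)
  have h2 := hX.connected.dist_triangle (u := s) (v := t) (w := w)
  rw [SimpleGraph.dist_eq_one_iff_adj.2 (K.adj_of_mem hst)] at h2
  omega

/-- A hyperplane separating a vertex of the first carrier of a chain from a vertex of the last one
crosses one of the carriers. -/
lemma exists_dist_le_one_of_chain (hX : IsQuasiMedian X) {g : ℕ → Hyperplane X}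
    (K : Hyperplane X) {y : V} (k i : ℕ)
    (hadj : ∀ j, i ≤ j → j < i + k → (contactGraph X).Adj (g j) (g (j + 1)))
    (hy : y ∈ hypCarrier X (g (i + k))) {z : V} (hz : z ∈ hypCarrier X (g i)) (h : K.Sep z y) :
    ∃ j, i ≤ j ∧ j ≤ i + k ∧ (contactGraph X).dist K (g j) ≤ 1 := by
  induction k generalizing i z with
  | zero => exact ⟨i, le_rfl, le_rfl, contactGraph_dist_le_one_of_sep hX hz hy h⟩
  | succ k ih =>
    obtain ⟨z', hz', hz''⟩ := exists_mem_hypCarrier_of_contact (hadj i le_rfl (by omega))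
    rcases h.cotrans hX z' with h | h
    · exact ⟨i, le_rfl, by omega, contactGraph_dist_le_one_of_sep hX hz hz' h⟩
    · obtain ⟨j, h1, h2, h3⟩ := ih (i + 1) (fun j h1 h2 => hadj j (by omega) (by omega))
        (by rwa [add_assoc, add_comm 1 k]) hz'' h
      exact ⟨j, by omega, by omega, h3⟩

/-- If `p` is the gate of `y` in `N(g i)`, the next hyperplane of a geodesic towards a hyperplane
whose carrier contains `y` can be chosen so that `p` belongs to its carrier. -/
lemma exists_replacement (hX : IsQuasiMedian X) {n : ℕ} {g : ℕ → Hyperplane X}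
    (hadj : ∀ j < n, (contactGraph X).Adj (g j) (g (j + 1)))
    (hn : (contactGraph X).dist (g 0) (g n) = n) {i : ℕ} (hi : i + 2 ≤ n) {p y : V}
    (hy : y ∈ hypCarrier X (g n)) (hp : p ∈ hypCarrier X (g i))
    (hgate : ∀ q ∈ hypCarrier X (g i), X.dist y p + X.dist p q = X.dist y q) :
    ∃ K : Hyperplane X, p ∈ hypCarrier X K ∧ (contactGraph X).Adj (g i) K ∧
      (contactGraph X).Adj K (g (i + 2)) := by
  by_cases hpm : p ∈ hypCarrier X (g (i + 1))
  · exact ⟨g (i + 1), hpm, hadj i (by omega), hadj (i + 1) (by omega)⟩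
  obtain ⟨r, hr, hrgate⟩ := (g (i + 1)).exists_gate hX p
  obtain ⟨c, hc, hc'⟩ := exists_mem_hypCarrier_of_contact (hadj i (by omega))
  have hri : r ∈ hypCarrier X (g i) :=
    (g i).mem_hypCarrier_of_geodesic hX hp hc (hrgate c hc')
  obtain ⟨p', hpp, hp'⟩ := exists_adj_closer hX (p := p) (q := r) (by rintro rfl; exact hpm hr)
  obtain ⟨K, hK⟩ : ∃ K : Hyperplane X, s(p, p') ∈ K.1 := ⟨_, Hyperplane.mem_ofAdj hpp⟩
  have hpK := Hyperplane.left_mem_hypCarrier hK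
  have hsep : K.Sep p r := K.sep_of_geodesic hX hK (by
    rw [SimpleGraph.dist_self]
    omega)
  have hyp : ¬ K.Sep y p := fun h => h.not_sep_of_geodesic hX (hgate r hri) hsep
  have hry : K.Sep r y := (hsep.symm.cotrans hX y).resolve_right hyp
  obtain ⟨z, hz, hz'⟩ := exists_mem_hypCarrier_of_contact (hadj (i + 1) (by omega))
  have hzy : K.Sep z y := (hry.cotrans hX z).resolve_left
    (hsep.not_sep_of_geodesic hX (hrgate z hz))
  obtain ⟨j, h1, h2, h3⟩ := exists_dist_le_one_of_chain hX K (n - (i + 2)) (i + 2)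
    (fun j _ _ => hadj j (by omega)) (by rwa [Nat.add_sub_cancel' hi]) hz' hzy
  have hG := contactGraph_connected hX (g 0)
  have d1 := contactGraph_dist_le_one hp hpK
  have d2 := hG.dist_triangle (u := g i) (v := K) (w := g j)
  have d3 := dist_of_geodesic hG hadj hn (i := i) (j := j) (by omega) (by omega)
  obtain rfl : j = i + 2 := by omega
  exact ⟨K, hpK, SimpleGraph.dist_eq_one_iff_adj.1 (by omega),
    SimpleGraph.dist_eq_one_iff_adj.1 (by omega)⟩

/-- The carriers of some geodesic of the contact graph follow a geodesic from `x` to `y`. -/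
lemma exists_geodesic_following (hX : IsQuasiMedian X) {A B : Hyperplane X} {n : ℕ}
    (hAB : (contactGraph X).dist A B = n) {x y : V} (hx : x ∈ hypCarrier X A)
    (hy : y ∈ hypCarrier X B) (i : ℕ) (hi : i + 1 ≤ n) :
    ∃ (g : ℕ → Hyperplane X) (p : V), g 0 = A ∧ g n = B ∧
      (∀ j < n, (contactGraph X).Adj (g j) (g (j + 1))) ∧ p ∈ hypCarrier X (g i) ∧
      (i ≠ 0 → p ∈ hypCarrier X (g (i - 1))) ∧ X.dist x p + X.dist p y = X.dist x y := by
  induction i with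
  | zero =>
    obtain ⟨w, hw⟩ := (contactGraph_reachable hX A B).exists_walk_length_eq_dist
    rw [hAB] at hw
    exact ⟨w.getVert, x, w.getVert_zero, hw ▸ w.getVert_length,
      fun j hj => w.adj_getVert_succ (hw ▸ hj), w.getVert_zero.symm ▸ hx, fun h => absurd rfl h,
      by simp⟩
  | succ i ih =>
    obtain ⟨g, p, h0, hn, hadj, hp, -, hd⟩ := ih (by omega)
    obtain ⟨q, hq, hgate⟩ := (g i).exists_gate hX y
    obtain ⟨K, hqK, hK1, hK2⟩ := exists_replacement hX hadj (by rw [h0, hn, hAB]) hi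
      (hn ▸ hy) hq hgate
    refine ⟨Function.update g (i + 1) K, q, ?_, ?_, ?_, ?_, ?_, ?_⟩
    · rwa [Function.update_of_ne (by omega)]
    · rwa [Function.update_of_ne (by omega)]
    · intro j hj
      rcases (show j = i ∨ j = i + 1 ∨ (j ≠ i ∧ j ≠ i + 1) by omega) with rfl | rfl | ⟨h1, h2⟩
      · rwa [Function.update_self, Function.update_of_ne (by omega)]
      · rwa [Function.update_self, Function.update_of_ne (by omega)]
      · rw [Function.update_of_ne h2, Function.update_of_ne (by omega)]
        exact hadj j hj
    · rwa [Function.update_self]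
    · intro _
      rwa [Nat.add_sub_cancel, Function.update_of_ne (by omega)]
    · have e1 := hgate p hp
      have e2 := hX.connected.dist_triangle (u := x) (v := p) (w := q)
      have e3 := hX.connected.dist_triangle (u := x) (v := q) (w := y)
      have c1 := X.dist_comm (u := y) (v := q)
      have c2 := X.dist_comm (u := p) (v := q)
      have c3 := X.dist_comm (u := p) (v := y)
      omega

/-- Two carriers contain vertices that are gates of each other. -/
lemma exists_mutual_gates (hX : IsQuasiMedian X) (A B : Hyperplane X) :
    ∃ x ∈ hypCarrier X A, ∃ y ∈ hypCarrier X B,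
      (∀ u ∈ hypCarrier X A, X.dist y x + X.dist x u = X.dist y u) ∧
      ∀ u ∈ hypCarrier X B, X.dist x y + X.dist y u = X.dist x u := by
  obtain ⟨a, ha⟩ := A.hypCarrier_nonempty
  obtain ⟨y, hy, hay⟩ := B.exists_gate hX a
  obtain ⟨x, hx, hyx⟩ := A.exists_gate hX y
  obtain ⟨z, hz, hxz⟩ := B.exists_gate hX x
  have h1 := hay z hz
  have h2 := hyx a ha
  have h3 := hxz y hy
  have h4 := hX.connected.dist_triangle (u := a) (v := x) (w := z)
  have c1 := X.dist_comm (u := y) (v := x)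
  have c2 := X.dist_comm (u := a) (v := x)
  have c3 := X.dist_comm (u := a) (v := y)
  have c4 := X.dist_comm (u := y) (v := z)
  obtain rfl := hX.connected.dist_eq_zero_iff.1 (show X.dist z y = 0 by omega)
  exact ⟨x, hx, z, hy, hyx, hxz⟩

end

/-- **Proposition (midpoints are close to separating hyperplanes).** If `A`, `B` are
hyperplanes of a quasi-median graph `X` with `d_{𝒞X}(A,B) ≥ 2`, then there are a geodesic
`A = g₀, …, g_n = B` in `𝒞X` and a hyperplane `C` separating `N(A)` from `N(B)` such that
the midpoint `M` of the geodesic (the point at parameter `n/2`) satisfies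
`d_{𝒞X}(M, C) ≤ 3/2`, witnessed by a vertex `g i` with `|i - n/2| + d(g i, C) ≤ 3/2`. -/
theorem midpoint_close_to_separating_hyperplane {V : Type*} (X : SimpleGraph V)
    (hX : IsQuasiMedian X) (A B : Hyperplane X)
    (h2 : 2 ≤ (contactGraph X).dist A B) :
    ∃ (n : ℕ) (g : ℕ → Hyperplane X) (i : ℕ) (C : Hyperplane X),
      n = (contactGraph X).dist A B ∧ g 0 = A ∧ g n = B ∧
      (∀ j < n, (contactGraph X).Adj (g j) (g (j + 1))) ∧ i ≤ n ∧
      SeparatesSets X C.1 (hypCarrier X A) (hypCarrier X B) ∧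
      |(i : ℝ) - (n : ℝ) / 2| + ((contactGraph X).dist (g i) C : ℝ) ≤ 3 / 2 := by
  obtain ⟨n, hn⟩ : ∃ n, (contactGraph X).dist A B = n := ⟨_, rfl⟩
  rw [hn] at h2
  obtain ⟨x, hx, y, hy, hyx, hxy⟩ := exists_mutual_gates hX A B
  obtain ⟨g, p, h0, hgn, hadj, hp, hp', hd⟩ :=
    exists_geodesic_following hX hn hx hy (n / 2) (by omega)
  have hp' := hp' (by omega)
  have hpy : p ≠ y := by
    rintro rfl
    have h1 := contactGraph_dist_le_one hp' (hgn ▸ hy)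
    rw [dist_of_geodesic (contactGraph_connected hX A) hadj (by rw [h0, hgn, hn])
      (show n / 2 - 1 ≤ n by omega) le_rfl] at h1
    omega
  obtain ⟨p₁, hpp, hp₁⟩ := exists_adj_closer hX hpy
  obtain ⟨C, hC⟩ : ∃ C : Hyperplane X, s(p, p₁) ∈ C.1 := ⟨_, Hyperplane.mem_ofAdj hpp⟩
  have hsep : C.Sep x y := C.sep_of_geodesic hX hC (by omega)
  refine ⟨n, g, n / 2, C, hn.symm, h0, hgn, hadj, by omega, ⟨?_, ?_, x, hx, y, hy,
    (C.separates_iff_sep hX).2 hsep⟩, ?_⟩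
  · intro u hu w hw h
    exact (((C.separates_iff_sep hX).1 h).cotrans hX x).elim
      (fun h => hsep.symm.not_sep_of_geodesic hX (hyx u hu) h.symm)
      (hsep.symm.not_sep_of_geodesic hX (hyx w hw))
  · intro u hu w hw h
    exact (((C.separates_iff_sep hX).1 h).cotrans hX y).elim
      (fun h => hsep.not_sep_of_geodesic hX (hxy u hu) h.symm)
      (hsep.not_sep_of_geodesic hX (hxy w hw))
  · have h1 : ((contactGraph X).dist (g (n / 2)) C : ℝ) ≤ 1 := by
      exact_mod_cast contactGraph_dist_le_one hp (Hyperplane.left_mem_hypCarrier hC)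
    have h3 : (n : ℝ) = 2 * (n / 2 : ℕ) + (n % 2 : ℕ) := by
      exact_mod_cast (Nat.div_add_mod n 2).symm
    have h4 : ((n % 2 : ℕ) : ℝ) ≤ 1 := by
      exact_mod_cast Nat.le_of_lt_succ (Nat.mod_lt n two_pos)
    have h5 : |((n / 2 : ℕ) : ℝ) - (n : ℝ) / 2| ≤ 1 / 2 := by
      rw [abs_le]
      constructor <;> linarith [Nat.cast_nonneg (α := ℝ) (n % 2)]
    linarith

end QM
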